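/- arXiv:2512.02596 — 4 statements merged into one kernel-verified Lean document; each statement's English description precedes it below -/
import Mathlib

section
/- Let S be a dense subsemigroup of ((0,∞),+) and let A₁, A₂ ⊆ S. If A₁ ∪ A₂ is a P set near zero, then A₁ is a P set near zero or A₂ is a P set near zero (i.e., the property of being a P set near zero is partition regular). -/
open Set

/-- `A` is a *P set near zero* in a dense subsemigroup `S` of `((0,∞),+)`:
for every `k ∈ ℕ` and every `ε > 0` there exist `a, d ∈ S` such that
`a + t·d ∈ A ∩ (0,ε)` for all `t ∈ {1,…,k}`. -/
def PSetNearZero (S A : Set ℝ) : Prop :=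
  ∀ k : ℕ, ∀ ε : ℝ, 0 < ε → ∃ a ∈ S, ∃ d ∈ S,
    ∀ t : ℕ, 1 ≤ t → t ≤ k → a + (t : ℝ) * d ∈ A ∩ Set.Ioo 0 ε

/-- Finitary van der Waerden theorem: for every finite set of colours and every length there is a bound
`N` such that any colouring of `ℕ` admits a monochromatic arithmetic progression below `N`. -/
theorem exists_mono_arithmetic_progression_le (κ : Type*) [Finite κ] (k : ℕ) :
    ∃ N : ℕ, ∀ C : ℕ → κ, ∃ b e : ℕ, 0 < e ∧
      ∃ c : κ, ∀ t ≤ k, b + t * e ≤ N ∧ C (b + t * e) = c := by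
  classical
  obtain ⟨ι, hι, hmono⟩ := Combinatorics.Line.exists_mono_in_high_dimension (Fin (k + 1)) κ
  refine ⟨Fintype.card ι * k, fun C => ?_⟩
  obtain ⟨l, c, hl⟩ := hmono fun v => C (∑ i, (v i : ℕ))
  have hsum : ∀ x : Fin (k + 1), ∑ i, (l x i : ℕ) =
      (∑ i, (l.idxFun i).elim 0 (fun y => (y : ℕ))) +
        x * (Finset.univ.filter fun i => l.idxFun i = none).card := by
    intro x
    rw [Finset.card_filter, Finset.mul_sum, ← Finset.sum_add_distrib]
    refine Finset.sum_congr rfl fun i _ => ?_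
    cases hi : l.idxFun i <;> simp [hi]
  obtain ⟨i₀, hi₀⟩ := l.proper
  refine ⟨∑ i, (l.idxFun i).elim 0 (fun y => (y : ℕ)),
    (Finset.univ.filter fun i => l.idxFun i = none).card,
    Finset.card_pos.2 ⟨i₀, by simpa using hi₀⟩, c, fun t ht => ?_⟩
  have hst := hsum ⟨t, Nat.lt_succ_of_le ht⟩
  rw [← hst]
  refine ⟨?_, hl _⟩
  calc ∑ i, (l ⟨t, Nat.lt_succ_of_le ht⟩ i : ℕ) ≤ ∑ _i : ι, k :=
        Finset.sum_le_sum fun i _ => Nat.le_of_lt_succ (Fin.is_lt _)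
    _ = Fintype.card ι * k := by simp

/-- Positive natural multiples stay in an additively closed set of reals. -/
theorem natCast_mul_mem_of_add_mem {S : Set ℝ} (hS : ∀ x ∈ S, ∀ y ∈ S, x + y ∈ S)
    {x : ℝ} (hx : x ∈ S) {n : ℕ} (hn : 0 < n) : (n : ℝ) * x ∈ S := by
  induction n, hn using Nat.le_induction with
  | base => simpa using hx
  | succ n _ ih =>
    rw [Nat.cast_add, Nat.cast_one, add_mul, one_mul]
    exact hS _ ih _ hx

/-- The property of being a P set near zero is partition regular: if `S` is a dense
subsemigroup of `((0,∞),+)`, `A₁, A₂ ⊆ S` and `A₁ ∪ A₂` is a P set near zero, then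
`A₁` is a P set near zero or `A₂` is a P set near zero. -/
theorem pSetNearZero_partition_regular (S : Set ℝ)
    (hSpos : S ⊆ Set.Ioi 0)
    (hSadd : ∀ x ∈ S, ∀ y ∈ S, x + y ∈ S)
    (hSdense : ∀ a b : ℝ, 0 < a → a < b → ∃ s ∈ S, a < s ∧ s < b)
    (A₁ A₂ : Set ℝ) (hA₁ : A₁ ⊆ S) (hA₂ : A₂ ⊆ S)
    (h : PSetNearZero S (A₁ ∪ A₂)) :
    PSetNearZero S A₁ ∨ PSetNearZero S A₂ := by
  by_contra hcon
  simp only [not_or, PSetNearZero, not_forall] at hcon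
  obtain ⟨⟨k₁, ε₁, hε₁, h₁⟩, k₂, ε₂, hε₂, h₂⟩ := hcon
  obtain ⟨N, hN⟩ := exists_mono_arithmetic_progression_le Prop (max k₁ k₂)
  obtain ⟨a, ha, d, hd, had⟩ := h (N + 1) (min ε₁ ε₂) (lt_min hε₁ hε₂)
  obtain ⟨b, e, he, c, hc⟩ := hN fun s => a + ((s + 1 : ℕ) : ℝ) * d ∈ A₁
  have ha' : a + ((b + 1 : ℕ) : ℝ) * d ∈ S :=
    hSadd _ ha _ (natCast_mul_mem_of_add_mem hSadd hd b.succ_pos)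
  have hd' : (e : ℝ) * d ∈ S := natCast_mul_mem_of_add_mem hSadd hd he
  have hpt : ∀ t : ℕ, a + ((b + 1 : ℕ) : ℝ) * d + (t : ℝ) * ((e : ℝ) * d) =
      a + ((b + t * e + 1 : ℕ) : ℝ) * d := by
    intro t
    push_cast
    ring
  by_cases hcol : c
  · refine h₁ ⟨_, ha', _, hd', fun t _ ht => ?_⟩
    obtain ⟨hle, hmem⟩ := hc t (ht.trans (le_max_left _ _))
    obtain ⟨-, hpos, hlt⟩ := had (b + t * e + 1) (by omega) (by omega)
    rw [hpt]
    exact ⟨hmem.mpr hcol, hpos, hlt.trans_le (min_le_left _ _)⟩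
  · refine h₂ ⟨_, ha', _, hd', fun t _ ht => ?_⟩
    obtain ⟨hle, hmem⟩ := hc t (ht.trans (le_max_right _ _))
    obtain ⟨hunion, hpos, hlt⟩ := had (b + t * e + 1) (by omega) (by omega)
    rw [hpt]
    exact ⟨hunion.resolve_left fun hA => hcol (hmem.mp hA), hpos,
      hlt.trans_le (min_le_right _ _)⟩
end

section
/- Let S be a dense subsemigroup of ((0,∞),+) and let A ⊆ S. Then there exists an idempotent p = p + p in 0⁺(S) with A ∈ p if and only if for every ε > 0 there is a sequence (xₙ)ₙ₌₁^∞ in (0,ε) ∩ S such that Σₙ₌₁^∞ xₙ converges (in ℝ) and FS((xₙ)ₙ₌₁^∞) ⊆ A, where FS((xₙ)ₙ₌₁^∞) = { Σ_{n∈F} xₙ : F a finite nonempty subset of ℕ }. -/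
open Set Filter

attribute [local instance] Ultrafilter.add Ultrafilter.addSemigroup

/-- `0⁺(S)`: the ultrafilters (on `ℝ`, identifying `βS` with the ultrafilters
containing `S`) containing `(0,ε) ∩ S` for every `ε > 0`. -/
def zeroPlus (S : Set ℝ) : Set (Ultrafilter ℝ) :=
  {p | ∀ ε : ℝ, 0 < ε → (Set.Ioo 0 ε ∩ S) ∈ p}

open Topology

/-- Every element of Hindman's set `FS a` is the sum of `a` over a nonempty finite index set. -/
theorem exists_finset_sum_eq_of_mem_FS {M : Type*} [AddCommMonoid M] {a : Stream' M} {m : M}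
    (hm : m ∈ Hindman.FS a) : ∃ F : Finset ℕ, F.Nonempty ∧ m = ∑ n ∈ F, a.get n := by
  induction hm with
  | head' a => exact ⟨{0}, by simp, by rw [Finset.sum_singleton]⟩
  | tail' a m _ ih =>
    obtain ⟨F, hF, rfl⟩ := ih
    refine ⟨F.map (addRightEmbedding 1), by simpa using hF, ?_⟩
    rw [Finset.sum_map]
    rfl
  | cons' a m _ ih =>
    obtain ⟨F, hF, rfl⟩ := ih
    refine ⟨insert 0 (F.map (addRightEmbedding 1)), Finset.insert_nonempty _ _, ?_⟩
    rw [Finset.sum_insert (by simp), Finset.sum_map]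
    rfl

/-- An idempotent ultrafilter on `ℝ` containing a bounded set converges to `0`. -/
theorem Ultrafilter.le_nhds_zero_of_add_self {U : Ultrafilter ℝ} (hU : U + U = U) {K : Set ℝ}
    (hK : IsCompact K) (hKU : K ∈ U) : (U : Filter ℝ) ≤ 𝓝 0 := by
  obtain ⟨l, -, hl⟩ := hK.ultrafilter_le_nhds U (le_principal_iff.2 hKU)
  have hadd : (U : Filter ℝ) ≤ 𝓝 (l + l) := by
    intro s hs
    obtain ⟨u, hu, v, hv, huv⟩ := mem_nhds_prod_iff.1 (continuous_add.tendsto (l, l) hs)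
    change ∀ᶠ m in (U : Filter ℝ), m ∈ s
    rw [← hU, Ultrafilter.eventually_add]
    filter_upwards [hl hu] with m hm
    filter_upwards [hl hv] with m' hm'
    exact huv (Set.mk_mem_prod hm hm')
  have h : l = l + l := tendsto_nhds_unique (f := id) hl hadd
  have h0 : l = 0 := by linarith
  rwa [h0] at hl

/-- Let `S` be a dense subsemigroup of `((0,∞),+)` and `A ⊆ S`.  There is an idempotent
`p = p + p` in `0⁺(S)` with `A ∈ p` iff for every `ε > 0` there is a sequence `(xₙ)`
in `(0,ε) ∩ S` whose series converges and with `FS((xₙ)) ⊆ A`. -/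
theorem exists_idempotent_in_zeroPlus_iff_FS (S : Set ℝ)
    (hSpos : S ⊆ Set.Ioi 0)
    (hSadd : ∀ x ∈ S, ∀ y ∈ S, x + y ∈ S)
    (hSdense : ∀ a b : ℝ, 0 < a → a < b → ∃ s ∈ S, a < s ∧ s < b)
    (A : Set ℝ) (hA : A ⊆ S) :
    (∃ p ∈ zeroPlus S, p + p = p ∧ A ∈ p) ↔
      ∀ ε : ℝ, 0 < ε → ∃ x : ℕ → ℝ,
        (∀ n, x n ∈ Set.Ioo 0 ε ∩ S) ∧ Summable x ∧
        ∀ F : Finset ℕ, F.Nonempty → (∑ n ∈ F, x n) ∈ A := by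
  constructor
  · rintro ⟨p, hp, hpp, hAp⟩ ε hε
    obtain ⟨a, ha⟩ := Hindman.exists_FS_of_large p hpp (A ∩ (Set.Ioo 0 ε ∩ S))
      (inter_mem hAp (hp ε hε))
    have hterm (n : ℕ) : a.get n ∈ Set.Ioo 0 ε ∩ S := (ha (Hindman.FS.singleton a n)).2
    have hsum (F : Finset ℕ) (hF : F.Nonempty) := ha (Hindman.FS.finsetSum a F hF)
    refine ⟨a.get, hterm, ?_, fun F hF => (hsum F hF).1⟩
    refine summable_of_sum_le (c := ε) (fun n => (hterm n).1.1.le) fun F => ?_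
    rcases F.eq_empty_or_nonempty with rfl | hF
    · simpa using hε.le
    · exact (hsum F hF).2.1.2.le
  · intro h
    obtain ⟨x, hx, hxs, hxA⟩ := h 1 one_pos
    obtain ⟨U, hU, hUx⟩ := Hindman.exists_idempotent_ultrafilter_le_FS (x : Stream' ℝ)
    have hUA : A ∈ U := by
      filter_upwards [hUx] with m hm
      obtain ⟨F, hF, rfl⟩ := exists_finset_sum_eq_of_mem_FS hm
      exact hxA F hF
    have hUbdd : Set.Icc 0 (∑' n, x n) ∈ U := by
      filter_upwards [hUx] with m hm
      obtain ⟨F, -, rfl⟩ := exists_finset_sum_eq_of_mem_FS hm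
      exact ⟨Finset.sum_nonneg fun n _ => (hx n).1.1.le,
        hxs.sum_le_tsum F fun n _ => (hx n).1.1.le⟩
    have hU0 := Ultrafilter.le_nhds_zero_of_add_self hU isCompact_Icc hUbdd
    refine ⟨U, fun ε hε => ?_, hU, hUA⟩
    filter_upwards [hUA, hU0 (Iio_mem_nhds hε)] with m hm hmε
    exact ⟨⟨hSpos (hA hm), hmε⟩, hA hm⟩
end

section
/- Let u, v ∈ ℕ, let M be a u × v first entries matrix with entries from ℝ, let C be a central set near zero in ℝ⁺, and let ε > 0. Then there exist sequences (x_{1,n})ₙ₌₁^∞, …, (x_{v,n})ₙ₌₁^∞ in ℝ⁺ such that for each i ∈ {1,…,v} the series Σₜ₌₁^∞ x_{i,t} converges, and for each finite nonempty F ⊆ ℕ, the vector x_F whose i-th entry is Σ_{t∈F} x_{i,t} satisfies x_F ∈ (0,ε)^v and M·x_F ∈ C^u. -/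
open Set Filter

attribute [local instance] Ultrafilter.add Ultrafilter.addSemigroup

/-- The positive reals `ℝ⁺ = (0,∞)` as a type, a discrete additive semigroup. -/
abbrev Rpos : Type := {x : ℝ // 0 < x}

/-- `0⁺(ℝ⁺)`: ultrafilters on `ℝ⁺` containing `(0,ε)` for every `ε > 0`. -/
def zeroPlus1 : Set (Ultrafilter Rpos) :=
  {p | ∀ ε : ℝ, 0 < ε → {x : Rpos | (x : ℝ) < ε} ∈ p}

/-- `0⁺((ℝ⁺)^v)`: ultrafilters on `(ℝ⁺)^v` containing `(0,ε)^v` for every `ε > 0`. -/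
def zeroPlusV (v : ℕ) : Set (Ultrafilter (Fin v → Rpos)) :=
  {p | ∀ ε : ℝ, 0 < ε → {x : Fin v → Rpos | ∀ j, (x j : ℝ) < ε} ∈ p}

/-- `I` is a (nonempty, two-sided) ideal of the subsemigroup `T` of the ultrafilter
semigroup `βγ`. -/
def IsIdealIn {γ : Type} [AddSemigroup γ] (T I : Set (Ultrafilter γ)) : Prop :=
  I.Nonempty ∧ I ⊆ T ∧ (∀ p ∈ T, ∀ q ∈ I, p + q ∈ I) ∧ ∀ p ∈ T, ∀ q ∈ I, q + p ∈ I

/-- `p` belongs to the smallest two-sided ideal `K(T)` of `T`: equivalently, `p ∈ T` and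
`p` belongs to every nonempty two-sided ideal of `T`. -/
def memK {γ : Type} [AddSemigroup γ] (T : Set (Ultrafilter γ)) (p : Ultrafilter γ) : Prop :=
  p ∈ T ∧ ∀ I : Set (Ultrafilter γ), IsIdealIn T I → p ∈ I

/-- `M` is a *first entries matrix*: no row is zero, the leftmost nonzero entry of each
row is positive, and rows whose first entries occur in the same column have equal first
entries. -/
def IsFirstEntriesMatrix {u v : ℕ} (M : Fin u → Fin v → ℝ) : Prop :=
  ∀ i : Fin u, ∃ j : Fin v, (∀ j' : Fin v, j' < j → M i j' = 0) ∧ 0 < M i j ∧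
    ∀ i' : Fin u, (∀ j' : Fin v, j' < j → M i' j' = 0) → M i' j ≠ 0 → M i' j = M i j

/-- `C ⊆ ℝ⁺` is *central near zero*: `C` belongs to some idempotent in `K(0⁺(ℝ⁺))`. -/
def CentralNearZero (C : Set ℝ) : Prop :=
  ∃ p : Ultrafilter Rpos, p + p = p ∧ memK zeroPlus1 p ∧ {x : Rpos | (x : ℝ) ∈ C} ∈ p

/-- Elements of the smallest ideal of a closed subsemigroup `T` lie in a minimal left ideal:
such a `p` satisfies `p ∈ T + x + p` for all `x ∈ T`. -/
lemma memK.exists_add_add_eq {γ : Type} [AddSemigroup γ] {T : Set (Ultrafilter γ)}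
    (hcl : IsClosed T) (hadd : ∀ x ∈ T, ∀ y ∈ T, x + y ∈ T) {p : Ultrafilter γ} (hp : memK T p)
    {x : Ultrafilter γ} (hx : x ∈ T) : ∃ t ∈ T, t + x + p = p := by
  let S : Set (Set (Ultrafilter γ)) :=
    {L | IsClosed L ∧ L.Nonempty ∧ L ⊆ T ∧ ∀ t ∈ T, ∀ y ∈ L, t + y ∈ L}
  obtain ⟨L, hL⟩ : ∃ L, Minimal (· ∈ S) L := by
    refine zorn_superset S fun c hcS hc => ?_
    obtain rfl | hne := c.eq_empty_or_nonempty
    · exact ⟨T, ⟨hcl, ⟨p, hp.1⟩, subset_rfl, hadd⟩, by simp⟩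
    refine ⟨⋂₀ c, ⟨isClosed_sInter fun t ht => (hcS ht).1, ?_, ?_, ?_⟩,
      fun s hs => sInter_subset_of_mem hs⟩
    · rw [sInter_eq_iInter]
      have := hne.coe_sort
      exact IsCompact.nonempty_iInter_of_directed_nonempty_isCompact_isClosed
        ((↑) : c → Set (Ultrafilter γ)) (DirectedOn.directed_val (IsChain.directedOn hc.symm))
        (fun i => (hcS i.prop).2.1) (fun i => (hcS i.prop).1.isCompact) (fun i => (hcS i.prop).1)
    · obtain ⟨s, hs⟩ := hne
      exact (sInter_subset_of_mem hs).trans (hcS hs).2.2.1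
    · exact fun t ht y hy s hs => (hcS hs).2.2.2 t ht y (hy s hs)
  obtain ⟨-, ⟨m, hm⟩, hLT, hLadd⟩ := hL.prop
  refine (hp.2 {q | q ∈ T ∧ ∀ x ∈ T, ∃ t ∈ T, t + x + q = q} ⟨⟨m, hLT hm, fun x hx => ?_⟩,
    fun q hq => hq.1, ?_, ?_⟩).2 x hx
  · have himg : (fun t => t + (x + m)) '' T = L := by
      apply hL.eq_of_subset
      · refine ⟨(Ultrafilter.continuous_add_left (x + m)).isClosedMap _ hcl,
          ⟨_, x, hx, rfl⟩, ?_, ?_⟩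
        · rintro _ ⟨t, ht, rfl⟩
          exact hadd t ht _ (hadd x hx m (hLT hm))
        · rintro s hs _ ⟨t, ht, rfl⟩
          exact ⟨s + t, hadd s hs t ht, add_assoc _ _ _⟩
      · rintro _ ⟨t, ht, rfl⟩
        exact hLadd t ht _ (hLadd x hx m hm)
    obtain ⟨t, ht, h⟩ := himg.symm ▸ hm
    exact ⟨t, ht, (add_assoc _ _ _).trans h⟩
  · rintro s hs q ⟨hq, h⟩
    refine ⟨hadd s hs q hq, fun x hx => ?_⟩
    obtain ⟨t, ht, h⟩ := h (x + s) (hadd x hx s hs)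
    refine ⟨s + t, hadd s hs t ht, ?_⟩
    conv_rhs => rw [← h]
    simp only [add_assoc]
  · rintro s hs q ⟨hq, h⟩
    refine ⟨hadd q hq s hs, fun x hx => ?_⟩
    obtain ⟨t, ht, h⟩ := h x hx
    exact ⟨t, ht, by rw [← add_assoc, h]⟩

/-- Idempotents in the smallest ideal are minimal. -/
lemma memK.eq_of_idempotent_le {γ : Type} [AddSemigroup γ] {T : Set (Ultrafilter γ)}
    (hcl : IsClosed T) (hadd : ∀ x ∈ T, ∀ y ∈ T, x + y ∈ T) {p f : Ultrafilter γ} (hp : memK T p)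
    (hf : f ∈ T) (hff : f + f = f) (hpf : p + f = f) (hfp : f + p = f) : f = p := by
  obtain ⟨t, -, ht⟩ := hp.exists_add_add_eq hcl hadd hf
  have h : t + f = p := by rw [← ht, add_assoc, hfp]
  rw [← hpf, ← h, add_assoc, hff]

lemma Ultrafilter.isClosed_setOf_coe_le {α : Type*} (F : Filter α) :
    IsClosed {r : Ultrafilter α | (r : Filter α) ≤ F} := by
  have h : {r : Ultrafilter α | (r : Filter α) ≤ F} = ⋂ s ∈ F, {r : Ultrafilter α | s ∈ r} := by
    ext r
    simp [Filter.le_def]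
  rw [h]
  exact isClosed_biInter fun s _ => ultrafilter_isClosed_basic s

lemma Ultrafilter.map_add {α β : Type*} [Add α] [Add β] (φ : α → β)
    (hφ : ∀ x y, φ (x + y) = φ x + φ y) (r s : Ultrafilter α) :
    (r + s).map φ = r.map φ + s.map φ := by
  refine Ultrafilter.coe_inj.mp <| Filter.ext' fun P => ?_
  simp only [Ultrafilter.eventually_add, Ultrafilter.coe_map, Filter.eventually_map, hφ]

lemma Ultrafilter.pure_zero_add {α : Type*} [AddZeroClass α] (r : Ultrafilter α) :
    pure 0 + r = r := by
  refine Ultrafilter.coe_inj.mp <| Filter.ext' fun P => ?_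
  simp [Ultrafilter.eventually_add]

lemma Ultrafilter.add_pure_zero {α : Type*} [AddZeroClass α] (r : Ultrafilter α) :
    r + pure 0 = r := by
  refine Ultrafilter.coe_inj.mp <| Filter.ext' fun P => ?_
  simp [Ultrafilter.eventually_add]

lemma Ultrafilter.add_le_nhds_zero {V : Type*} [TopologicalSpace V] [AddMonoid V] [ContinuousAdd V]
    {r s : Ultrafilter V} (hr : (r : Filter V) ≤ nhds 0) (hs : (s : Filter V) ≤ nhds 0) :
    ((r + s : Ultrafilter V) : Filter V) ≤ nhds 0 := by
  intro A hA
  have hA : ∀ᶠ x in nhds (0 + 0 : V), x ∈ A := by simpa using hA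
  have h := (tendsto_add (a := (0 : V)) (b := 0)).eventually hA
  rw [nhds_prod_eq] at h
  exact (Ultrafilter.eventually_add r s (· ∈ A)).2
    ((h.curry.filter_mono hr).mono fun x hx => hx.filter_mono hs)

/-- Positive ultrafilters form a right ideal among the ultrafilters converging to zero. -/
lemma Ultrafilter.eventually_pos_add {r s : Ultrafilter ℝ} (hr : ∀ᶠ x in (r : Filter ℝ), 0 < x)
    (hs : (s : Filter ℝ) ≤ nhds 0) : ∀ᶠ x in ((r + s : Ultrafilter ℝ) : Filter ℝ), 0 < x := by
  refine (Ultrafilter.eventually_add r s (0 < ·)).2 (hr.mono fun x hx => ?_)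
  filter_upwards [hs (lt_mem_nhds (neg_lt_zero.2 hx))] with y hy
  have : -x < y := hy
  linarith

lemma mem_zeroPlus1_iff {p : Ultrafilter Rpos} :
    p ∈ zeroPlus1 ↔ (p.map Subtype.val : Filter ℝ) ≤ nhds 0 := by
  constructor
  · intro h A hA
    obtain ⟨ε, hε, hA⟩ := Metric.mem_nhds_iff.1 hA
    refine Filter.mem_map.2 (Filter.mem_of_superset (h ε hε) fun x hx => hA ?_)
    have hx : (x : ℝ) < ε := hx
    simpa [abs_of_pos x.2] using hx
  · exact fun h ε hε => h (gt_mem_nhds hε)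

lemma zeroPlus1_add {p q : Ultrafilter Rpos} (hp : p ∈ zeroPlus1) (hq : q ∈ zeroPlus1) :
    p + q ∈ zeroPlus1 := by
  rw [mem_zeroPlus1_iff] at *
  rw [Ultrafilter.map_add _ fun _ _ => rfl]
  exact Ultrafilter.add_le_nhds_zero hp hq

lemma isClosed_zeroPlus1 : IsClosed zeroPlus1 := by
  have h : zeroPlus1 =
      {p : Ultrafilter Rpos | (p : Filter Rpos) ≤ (nhds (0 : ℝ)).comap Subtype.val} := by
    ext p
    rw [mem_zeroPlus1_iff, Ultrafilter.coe_map, Filter.map_le_iff_le_comap]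
    rfl
  rw [h]
  exact Ultrafilter.isClosed_setOf_coe_le _

/-- An idempotent of `K(0⁺)` stays minimal among all ultrafilters on `ℝ` converging to zero. -/
lemma eq_map_val_of_idempotent_le {p : Ultrafilter Rpos} (hp : memK zeroPlus1 p)
    {g : Ultrafilter ℝ} (hg : (g : Filter ℝ) ≤ nhds 0) (hgg : g + g = g)
    (hpg : p.map Subtype.val + g = g) (hgp : g + p.map Subtype.val = g) :
    g = p.map Subtype.val := by
  have hpos : ∀ᶠ x in (g : Filter ℝ), 0 < x := by
    rw [← hpg]
    exact Ultrafilter.eventually_pos_add 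
      (Filter.eventually_map.2 (Filter.Eventually.of_forall fun x : Rpos => x.2)) hg
  have hinj : Function.Injective (Ultrafilter.map (Subtype.val : Rpos → ℝ)) := fun a b h =>
    Ultrafilter.coe_inj.mp (Filter.map_injective Subtype.val_injective (congrArg Ultrafilter.toFilter h))
  obtain ⟨f, rfl⟩ : ∃ f : Ultrafilter Rpos, f.map Subtype.val = g := by
    have hrange : range (Subtype.val : Rpos → ℝ) ∈ (g : Filter ℝ) :=
      hpos.mono fun x hx => ⟨⟨x, hx⟩, rfl⟩
    refine ⟨g.comap Subtype.val_injective hrange, Ultrafilter.coe_inj.mp ?_⟩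
    rw [Ultrafilter.coe_map, Ultrafilter.coe_comap, Filter.map_comap_of_mem hrange]
  have hval := Ultrafilter.map_add (Subtype.val : Rpos → ℝ) fun _ _ => rfl
  simp only [← hval] at hgg hpg hgp
  rw [hp.eq_of_idempotent_le isClosed_zeroPlus1 (fun _ hx _ hy => zeroPlus1_add hx hy)
    (mem_zeroPlus1_iff.2 hg) (hinj hgg) (hinj hpg) (hinj hgp)]

/-- Below an idempotent `e` lying over `0` there is an idempotent lying over any given
idempotent `q`. -/
lemma exists_idempotent_le_map_eq {V W : Type*} [TopologicalSpace V] [AddMonoid V]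
    [ContinuousAdd V] [AddMonoid W] (π : V → W) (hπ : ∀ x y, π (x + y) = π x + π y)
    {e : Ultrafilter V} (he : e + e = e) (he0 : (e : Filter V) ≤ nhds 0) (heπ : e.map π = pure 0)
    {q : Ultrafilter W} (hq : q + q = q)
    (hne : ∃ i : Ultrafilter V, (i : Filter V) ≤ nhds 0 ∧ i.map π = q) :
    ∃ f : Ultrafilter V, f + f = f ∧ (f : Filter V) ≤ nhds 0 ∧ f.map π = q ∧
      e + f = f ∧ f + e = f := by
  let I : Set (Ultrafilter V) := {i | (i : Filter V) ≤ nhds 0 ∧ i.map π = q}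
  have hI : I = {i : Ultrafilter V | (i : Filter V) ≤ nhds 0 ⊓ (q : Filter W).comap π} := by
    ext i
    change _ ∧ _ ↔ (i : Filter V) ≤ nhds 0 ⊓ (q : Filter W).comap π
    rw [le_inf_iff, ← Filter.map_le_iff_le_comap, ← Ultrafilter.coe_map,
      Ultrafilter.coe_le_coe]
  have hIcl : IsClosed I := hI ▸ Ultrafilter.isClosed_setOf_coe_le _
  have hadd : ∀ i ∈ I, ∀ j ∈ I, i + e + j ∈ I := by
    rintro i ⟨hi, hi'⟩ j ⟨hj, hj'⟩
    refine ⟨Ultrafilter.add_le_nhds_zero (Ultrafilter.add_le_nhds_zero hi he0) hj, ?_⟩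
    rw [Ultrafilter.map_add π hπ, Ultrafilter.map_add π hπ, hi', hj', heπ,
      Ultrafilter.add_pure_zero, hq]
  obtain ⟨w, ⟨i, hi, hw⟩, hww⟩ := exists_idempotent_in_compact_add_subsemigroup
    Ultrafilter.continuous_add_left ((· + e) '' I) (Set.Nonempty.image _ hne)
    (hIcl.isCompact.image (Ultrafilter.continuous_add_left e)) (by
      rintro _ ⟨i, hi, rfl⟩ _ ⟨j, hj, rfl⟩
      exact ⟨i + e + j, hadd i hi j hj, add_assoc _ _ _⟩)
  have hwe : w + e = w := by rw [← hw, add_assoc, he]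
  refine ⟨e + w, ?_, ?_, ?_, ?_, ?_⟩
  · rw [add_assoc, ← add_assoc w, hwe, hww]
  · rw [← hw]
    exact Ultrafilter.add_le_nhds_zero he0 (Ultrafilter.add_le_nhds_zero hi.1 he0)
  · rw [← hw, Ultrafilter.map_add π hπ, Ultrafilter.map_add π hπ, hi.2, heπ,
      Ultrafilter.add_pure_zero, Ultrafilter.pure_zero_add]
  · rw [← add_assoc, he]
  · rw [add_assoc, hwe]

/-- Every minimal idempotent of `0⁺` is the image, under all rows of a first entries matrix
simultaneously, of an idempotent on the positive vectors converging to zero. -/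
lemma exists_idempotent_map_rows_eq {p : Ultrafilter Rpos} (hpp : p + p = p)
    (hp : memK zeroPlus1 p) (v : ℕ) {ι : Type} (M : ι → Fin v → ℝ)
    (hM : ∀ i, ∃ j, (∀ j' < j, M i j' = 0) ∧ 0 < M i j ∧
      ∀ i', (∀ j' < j, M i' j' = 0) → M i' j ≠ 0 → M i' j = M i j) :
    ∃ q : Ultrafilter (Fin v → ℝ), q + q = q ∧ (q : Filter (Fin v → ℝ)) ≤ nhds 0 ∧
      (∀ j, ∀ᶠ x in (q : Filter (Fin v → ℝ)), 0 < x j) ∧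
      ∀ i, q.map (fun x => ∑ j, M i j * x j) = p.map Subtype.val := by
  induction v generalizing ι with
  | zero =>
    exact ⟨pure 0, Ultrafilter.pure_zero_add _, pure_le_nhds 0, fun j => j.elim0,
      fun i => (hM i).choose.elim0⟩
  | succ v ih =>
    obtain ⟨q, hqq, hq0, hqpos, hqM⟩ := ih (ι := {i // M i 0 = 0}) (fun i j => M i j.succ) (by
      rintro ⟨i, hi⟩
      obtain ⟨j, hj, hpos, heq⟩ := hM i
      obtain ⟨j, rfl⟩ := Fin.exists_succ_eq.2 (show j ≠ 0 by rintro rfl; exact hpos.ne' hi)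
      refine ⟨j, fun j' hj' => hj _ (Fin.succ_lt_succ_iff.2 hj'), hpos, ?_⟩
      rintro ⟨i', hi'⟩ h
      refine heq i' fun j' hj' => ?_
      cases j' using Fin.cases with
      | zero => exact hi'
      | succ j' => exact h j' (Fin.succ_lt_succ_iff.1 hj'))
    obtain ⟨c, hc, hMc⟩ : ∃ c > 0, ∀ i, M i 0 ≠ 0 → M i 0 = c := by
      by_cases h : ∃ i, M i 0 ≠ 0
      · obtain ⟨i, hi⟩ := h
        obtain ⟨j, hj, hpos, heq⟩ := hM i
        obtain rfl : j = 0 := by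
          by_contra hj0
          exact hi (hj 0 (Fin.pos_of_ne_zero hj0))
        exact ⟨_, hpos, fun i' => heq i' (by simp)⟩
      · push Not at h
        exact ⟨1, one_pos, fun i hi => absurd (h i) hi⟩
    have hp0 : (p.map Subtype.val : Filter ℝ) ≤ nhds 0 := mem_zeroPlus1_iff.1 hp.1
    have hpp' : p.map Subtype.val + p.map Subtype.val = p.map (Subtype.val : Rpos → ℝ) := by
      rw [← Ultrafilter.map_add (Subtype.val : Rpos → ℝ) fun _ _ => rfl, hpp]
    let κ : ℝ → Fin (v + 1) → ℝ := fun a => Fin.cons (a / c) 0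
    have hκ : ∀ a b, κ (a + b) = κ a + κ b := by
      intro a b
      ext j
      cases j using Fin.cases <;> simp [κ, add_div]
    have hκ0 : Tendsto κ (nhds 0) (nhds 0) := by
      have h : Continuous κ := by
        refine continuous_pi fun j => ?_
        cases j using Fin.cases <;> simp only [κ, Fin.cons_zero, Fin.cons_succ] <;> fun_prop
      have hz : κ 0 = 0 := by
        ext j
        cases j using Fin.cases <;> simp [κ]
      simpa [hz] using h.tendsto 0
    let τ : (Fin v → ℝ) → Fin (v + 1) → ℝ := fun y => Fin.cons 0 y
    have hτ0 : Tendsto τ (nhds 0) (nhds 0) := by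
      have h : Continuous τ := by
        refine continuous_pi fun j => ?_
        cases j using Fin.cases <;> simp only [τ, Fin.cons_zero, Fin.cons_succ] <;> fun_prop
      have hz : τ 0 = 0 := by
        ext j
        cases j using Fin.cases <;> simp [τ]
      simpa [hz] using h.tendsto 0
    obtain ⟨f, hff, hf0, hfq, hef, hfe⟩ := exists_idempotent_le_map_eq
      (Fin.tail : (Fin (v + 1) → ℝ) → Fin v → ℝ) (fun _ _ => rfl)
      (e := (p.map Subtype.val).map κ) (by rw [← Ultrafilter.map_add κ hκ, hpp'])
      (hκ0.mono_left hp0) (by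
        rw [Ultrafilter.map_map]
        refine Ultrafilter.coe_inj.mp ?_
        exact Filter.map_const (f := (p.map Subtype.val : Filter ℝ)) (c := (0 : Fin v → ℝ))) hqq
      ⟨q.map τ, hτ0.mono_left hq0, by
        rw [Ultrafilter.map_map]
        exact Ultrafilter.map_id q⟩
    refine ⟨f, hff, hf0, fun j => ?_, fun i => ?_⟩
    · cases j using Fin.cases with
      | zero =>
        have h : ∀ᶠ x in (f.map (fun x => x 0) : Filter ℝ), 0 < x := by
          rw [← hef, Ultrafilter.map_add _ fun _ _ => rfl]
          refine Ultrafilter.eventually_pos_add ?_ ?_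
          · simp only [Ultrafilter.coe_map, Filter.eventually_map]
            exact Filter.Eventually.of_forall fun x : Rpos => div_pos x.2 hc
          · exact ((continuous_apply (0 : Fin (v + 1))).tendsto (0 : Fin (v + 1) → ℝ)).mono_left hf0
        exact h
      | succ j =>
        have h := hqpos j
        rw [← hfq] at h
        exact h
    · by_cases hi : M i 0 = 0
      · rw [← hqM ⟨i, hi⟩, ← hfq, Ultrafilter.map_map]
        congr 1
        ext x
        simp [Fin.sum_univ_succ, hi, Fin.tail]
      · have hφ : ∀ x y : Fin (v + 1) → ℝ,
            ∑ j, M i j * (x + y) j = ∑ j, M i j * x j + ∑ j, M i j * y j := by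
          intro x y
          simp [mul_add, Finset.sum_add_distrib]
        have hφe : ((p.map Subtype.val).map κ).map (fun x => ∑ j, M i j * x j) =
            p.map Subtype.val := by
          have hid : (fun x : Fin (v + 1) → ℝ => ∑ j, M i j * x j) ∘ κ = id := by
            ext a
            simp [κ, Fin.sum_univ_succ, hMc i hi, mul_div_cancel₀ _ hc.ne']
          rw [Ultrafilter.map_map, hid, Ultrafilter.map_id]
        refine eq_map_val_of_idempotent_le hp ?_ ?_ ?_ ?_
        · have h : Continuous fun x : Fin (v + 1) → ℝ => ∑ j, M i j * x j := by fun_prop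
          have h := h.tendsto 0
          simp only [Pi.zero_apply, mul_zero, Finset.sum_const_zero] at h
          exact h.mono_left hf0
        · rw [← Ultrafilter.map_add _ hφ, hff]
        · rw [← hφe, ← Ultrafilter.map_add _ hφ, hef]
        · rw [← hφe, ← Ultrafilter.map_add _ hφ, hfe]

/-- If `M` is a `u × v` first entries matrix with real entries, `C` is central near zero
in `ℝ⁺`, and `ε > 0`, then there are sequences `(x_{i,n})ₙ` (`1 ≤ i ≤ v`) in `ℝ⁺`, each
with convergent series, such that for each finite nonempty `F ⊆ ℕ` the vector
`x_F = (∑_{t∈F} x_{i,t})ᵢ` lies in `(0,ε)^v` and `M·x_F ∈ C^u`. -/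
theorem firstEntries_centralNearZero_sums {u v : ℕ} (hu : 1 ≤ u) (hv : 1 ≤ v)
    (M : Fin u → Fin v → ℝ) (hM : IsFirstEntriesMatrix M)
    (C : Set ℝ) (hC : C ⊆ Set.Ioi 0) (hcen : CentralNearZero C)
    (ε : ℝ) (hε : 0 < ε) :
    ∃ x : Fin v → ℕ → ℝ,
      (∀ i n, 0 < x i n) ∧ (∀ i, Summable (x i)) ∧
      ∀ F : Finset ℕ, F.Nonempty →
        (∀ i, (∑ t ∈ F, x i t) ∈ Set.Ioo 0 ε) ∧
        ∀ k : Fin u, (∑ j, M k j * ∑ t ∈ F, x j t) ∈ C := by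
  obtain ⟨p, hpp, hp, hpC⟩ := hcen
  obtain ⟨q, hqq, hq0, hqpos, hqM⟩ := exists_idempotent_map_rows_eq hpp hp v M hM
  have hB : {x : Fin v → ℝ | (∀ j, x j ∈ Set.Ioo 0 ε) ∧ ∀ k, ∑ j, M k j * x j ∈ C} ∈ q := by
    have hsmall : ∀ j, ∀ᶠ x in (q : Filter (Fin v → ℝ)), x j < ε := fun j =>
      hq0 (((continuous_apply j).tendsto (0 : Fin v → ℝ)).eventually (gt_mem_nhds hε))
    have hrow : ∀ k, ∀ᶠ x in (q : Filter (Fin v → ℝ)), ∑ j, M k j * x j ∈ C := by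
      intro k
      have h : C ∈ p.map Subtype.val := hpC
      rw [← hqM k] at h
      exact h
    exact (Filter.eventually_all.2 fun j => (hqpos j).and (hsmall j)).and
      (Filter.eventually_all.2 hrow)
  obtain ⟨a, ha⟩ := Hindman.exists_FS_of_large q hqq _ hB
  have hsum : ∀ F : Finset ℕ, F.Nonempty → (∀ i, (∑ t ∈ F, a.get t i) ∈ Set.Ioo 0 ε) ∧
      ∀ k : Fin u, (∑ j, M k j * ∑ t ∈ F, a.get t j) ∈ C := by
    intro F hF
    simpa only [Set.mem_ofPred_eq, Finset.sum_apply] using ha (Hindman.FS.finsetSum a F hF)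
  have hpos : ∀ i n, 0 < a.get n i := fun i n => by
    simpa using ((hsum {n} (Finset.singleton_nonempty n)).1 i).1
  refine ⟨fun i n => a.get n i, hpos, fun i => ?_, hsum⟩
  refine summable_of_sum_le (c := ε) (fun n => (hpos i n).le) fun F => ?_
  obtain rfl | hF := F.eq_empty_or_nonempty
  · simpa using hε.le
  · exact ((hsum F hF).1 i).2.le
end

section
/- Let u, v ∈ ℕ and let M be a u × v matrix with entries from ℝ⁺ ∪ {0} which is image partition regular over ℝ⁺. If C ⊆ ℝ⁺ is a thick set near zero in ℝ⁺, then {x ∈ (ℝ⁺)^v : M·x ∈ C^u} is a thick set near zero in (ℝ⁺)^v. -/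
open Set Filter

attribute [local instance] Ultrafilter.add Ultrafilter.addSemigroup

/-- `L` is a left ideal of the subsemigroup `T` of the ultrafilter semigroup `βγ`. -/
def IsLeftIdealIn {γ : Type} [AddSemigroup γ] (T L : Set (Ultrafilter γ)) : Prop :=
  L.Nonempty ∧ L ⊆ T ∧ ∀ p ∈ T, ∀ q ∈ L, p + q ∈ L

/-- `L` is a minimal left ideal of the subsemigroup `T`. -/
def IsMinimalLeftIdealIn {γ : Type} [AddSemigroup γ] (T L : Set (Ultrafilter γ)) : Prop :=
  IsLeftIdealIn T L ∧ ∀ L' : Set (Ultrafilter γ), IsLeftIdealIn T L' → L' ⊆ L → L' = L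

/-- `M` is image partition regular over `ℝ⁺` (IPR/ℝ⁺): whenever `ℝ⁺` is partitioned into
finitely many cells, there are a cell `i` and `x ∈ (ℝ⁺)^v` such that every entry of `M·x`
lies in `ℝ⁺` and in the cell `i`. -/
def IPR {u v : ℕ} (M : Fin u → Fin v → ℝ) : Prop :=
  ∀ (r : ℕ) (c : Rpos → Fin r), ∃ (i : Fin r) (x : Fin v → Rpos),
    ∀ k : Fin u, ∃ h : 0 < ∑ j, M k j * (x j : ℝ), c ⟨∑ j, M k j * (x j : ℝ), h⟩ = i

/-- `A ⊆ ℝ⁺` is a *thick set near zero*: there is a left ideal `L` of `0⁺(ℝ⁺)` with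
`A` belonging to every member of `L`. -/
def Thick1 (A : Set Rpos) : Prop :=
  ∃ L : Set (Ultrafilter Rpos), IsLeftIdealIn zeroPlus1 L ∧ ∀ p ∈ L, A ∈ p

/-- `A ⊆ (ℝ⁺)^v` is a *thick set near zero*: there is a left ideal `L` of `0⁺((ℝ⁺)^v)`
with `A` belonging to every member of `L`. -/
def ThickV (v : ℕ) (A : Set (Fin v → Rpos)) : Prop :=
  ∃ L : Set (Ultrafilter (Fin v → Rpos)), IsLeftIdealIn (zeroPlusV v) L ∧ ∀ p ∈ L, A ∈ p

open Topology in
/-- For all small `d`, the product `d * K` is below a given positive bound. -/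
lemma eventually_mul_lt_nhdsGT_zero (K : ℝ) {b : ℝ} (hb : 0 < b) :
    ∀ᶠ d in 𝓝[>] (0 : ℝ), d * K < b := by
  have h : Tendsto (fun d : ℝ => d * K) (𝓝 0) (𝓝 0) := by
    simpa using (tendsto_id (x := nhds (0 : ℝ))).mul_const K
  exact (h.mono_left nhdsWithin_le_nhds).eventually (gt_mem_nhds hb)

lemma abs_dotProduct_le_mul_sum {v : ℕ} (w Y : Fin v → ℝ) {d : ℝ} (hY : ∀ i, |Y i| < d) :
    |w ⬝ᵥ Y| ≤ d * ∑ i, |w i| := by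
  rw [dotProduct, Finset.mul_sum]
  refine (Finset.abs_sum_le_sum_abs _ _).trans (Finset.sum_le_sum fun i _ => ?_)
  rw [abs_mul, mul_comm]
  exact mul_le_mul_of_nonneg_right (hY i).le (abs_nonneg _)

open Topology in
/-- Along an ultrafilter, a sequence of vectors that is not eventually zero has a leading
direction `g`: it is asymptotic to `e • g` for a positive scale `e`, and the error vanishes in a
coordinate `m` in which the sequence does not. -/
lemma exists_leading_direction {v : ℕ} (U : Ultrafilter ℕ) (x : ℕ → Fin v → ℝ)
    (hx : ∀ᶠ n in (U : Filter ℕ), x n ≠ 0) :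
    ∃ (m : Fin v) (e : ℕ → ℝ) (g : Fin v → ℝ),
      (∀ᶠ n in (U : Filter ℕ), x n m ≠ 0) ∧ (∀ᶠ n in (U : Filter ℕ), 0 < e n) ∧
      (∀ᶠ n in (U : Filter ℕ), x n m - e n * g m = 0) ∧
      (∀ i, Tendsto (fun n => x n i / e n) U (𝓝 (g i))) ∧ (∀ i, |g i| ≤ 1) ∧
      ∀ i, (∀ᶠ n in (U : Filter ℕ), x n i = 0) → g i = 0 := by
  have hmax : ∀ᶠ n in (U : Filter ℕ), ∃ m ∈ (univ : Set (Fin v)),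
      x n m ≠ 0 ∧ ∀ i, |x n i| ≤ |x n m| := by
    filter_upwards [hx] with n hn
    obtain ⟨k, hk⟩ := Function.ne_iff.mp hn
    obtain ⟨m, -, hm⟩ := Finset.exists_max_image Finset.univ (fun i => |x n i|) ⟨k, by simp⟩
    refine ⟨m, mem_univ _, fun h0 => hk ?_, fun i => hm i (by simp)⟩
    simpa [h0] using hm k (by simp)
  obtain ⟨m, -, hm⟩ := (Ultrafilter.eventually_exists_mem_iff finite_univ).mp hmax
  obtain ⟨σ, hσ, hpos⟩ : ∃ σ : ℝ, σ * σ = 1 ∧ ∀ᶠ n in (U : Filter ℕ), 0 < σ * x n m := by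
    have : ∀ᶠ n in (U : Filter ℕ), 0 < x n m ∨ x n m < 0 := by
      filter_upwards [hm] with n hn
      exact hn.1.lt_or_gt.symm
    rcases Ultrafilter.eventually_or.mp this with h | h
    · exact ⟨1, by norm_num, by simpa using h⟩
    · exact ⟨-1, by norm_num, by simpa using h⟩
  have hσ1 : |σ| = 1 := by
    have : |σ| * |σ| = 1 := by rw [← abs_mul, hσ, abs_one]
    nlinarith [abs_nonneg σ]
  have hlim : ∀ i, ∃ t : ℝ, |t| ≤ 1 ∧
      Tendsto (fun n => x n i / (σ * x n m)) U (𝓝 t) := by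
    intro i
    have hb : ∀ᶠ n in (U : Filter ℕ), x n i / (σ * x n m) ∈ Icc (-1 : ℝ) 1 := by
      filter_upwards [hm, hpos] with n hn hp
      rw [mem_Icc, ← abs_le, abs_div, abs_mul, hσ1, one_mul]
      exact div_le_one_of_le₀ (hn.2 i) (abs_nonneg _)
    obtain ⟨t, ht, hle⟩ := isCompact_Icc.ultrafilter_le_nhds'
      (U.map fun n => x n i / (σ * x n m)) hb
    exact ⟨t, abs_le.mpr ht, hle⟩
  choose g hg1 hg using hlim
  refine ⟨m, fun n => σ * x n m, g, hm.mono fun n hn => hn.1, hpos, ?_, hg, hg1, ?_⟩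
  · have hgm : g m = σ := by
      refine tendsto_nhds_unique (hg m) (tendsto_const_nhds.congr' ?_)
      filter_upwards [hpos] with n hp
      rw [eq_div_iff hp.ne', ← mul_assoc, hσ, one_mul]
    refine Eventually.of_forall fun n => ?_
    rw [hgm]
    linear_combination -(x n m) * hσ
  · intro i hi
    refine tendsto_nhds_unique (hg i) (tendsto_const_nhds.congr' ?_)
    filter_upwards [hi] with n hn
    simp [hn]

open Topology in
/-- Suppose `T` contains, at every small scale `a`, translates of all finite subsets of `(-a, a)`
by elements of `(a, 2 a)`. If along an ultrafilter the linear forms in `P` and `R` are positive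
on `x`, and two forms in `R` whose values on `x` are comparable are asymptotically equal, then
there are arbitrarily small vectors on which the forms in `P` are positive and those in `R` take
values in `T`. -/
lemma exists_small_vector_dotProduct_mem {v : ℕ} (U : Ultrafilter ℕ) (T : Set ℝ) {a₀ : ℝ}
    (ha₀ : 0 < a₀)
    (hT : ∀ a, 0 < a → a ≤ a₀ → ∀ F : Finset ℝ, (∀ f ∈ F, |f| < a) →
      ∃ z, a < z ∧ z < 2 * a ∧ ∀ f ∈ F, z + f ∈ T)
    (S : Finset (Fin v)) : ∀ (x : ℕ → Fin v → ℝ) (P R : Finset (Fin v → ℝ)),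
      (∀ i ∉ S, ∀ᶠ n in (U : Filter ℕ), x n i = 0) →
      (∀ w ∈ P ∪ R, ∀ᶠ n in (U : Filter ℕ), 0 < w ⬝ᵥ x n) →
      (∀ w ∈ R, ∀ w' ∈ R, ∀ ρ : ℝ, 0 < ρ →
        Tendsto (fun n => (w ⬝ᵥ x n) / (w' ⬝ᵥ x n)) U (𝓝 ρ) → ρ = 1) →
      ∀ δ > 0, ∃ Y : Fin v → ℝ, (∀ i, |Y i| < δ) ∧ (∀ w ∈ P, 0 < w ⬝ᵥ Y) ∧
        ∀ w ∈ R, w ⬝ᵥ Y ∈ T := by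
  classical
  induction S using Finset.strongInduction with
  | H S ih =>
  intro x P R hS hpos hrat δ hδ
  by_cases hx : ∀ᶠ n in (U : Filter ℕ), x n = 0
  · have hempty : ∀ w, w ∉ P ∪ R := by
      intro w hw
      obtain ⟨n, h1, h2⟩ := ((hpos w hw).and hx).exists
      simp [h2] at h1
    exact ⟨0, fun i => by simpa using hδ, fun w hw => (hempty w (Finset.mem_union_left _ hw)).elim,
      fun w hw => (hempty w (Finset.mem_union_right _ hw)).elim⟩
  obtain ⟨m, e, g, hm, he, hgm, hg, hg1, hg0⟩ :=
    exists_leading_direction U x (Ultrafilter.eventually_not.mpr hx)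
  have hmS : m ∈ S := by
    by_contra h
    obtain ⟨n, h1, h2⟩ := (hm.and (hS m h)).exists
    exact h1 h2
  have hlim : ∀ w : Fin v → ℝ, Tendsto (fun n => (w ⬝ᵥ x n) / e n) U (𝓝 (w ⬝ᵥ g)) := by
    intro w
    simp only [dotProduct, Finset.sum_div, mul_div_assoc]
    exact tendsto_finsetSum _ fun i _ => (hg i).const_mul (w i)
  have hgnn : ∀ w ∈ P ∪ R, 0 ≤ w ⬝ᵥ g := by
    intro w hw
    refine ge_of_tendsto (hlim w) ?_
    filter_upwards [hpos w hw, he] with n h1 h2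
    positivity
  have hcommon : ∃ c > 0, ∀ w ∈ R, w ⬝ᵥ g ≠ 0 → w ⬝ᵥ g = c := by
    by_cases h : ∃ w₀ ∈ R, w₀ ⬝ᵥ g ≠ 0
    · obtain ⟨w₀, hw₀, h0⟩ := h
      have hc := (hgnn w₀ (Finset.mem_union_right _ hw₀)).lt_of_ne' h0
      refine ⟨_, hc, fun w hw hne => ?_⟩
      have hwp := (hgnn w (Finset.mem_union_right _ hw)).lt_of_ne' hne
      refine (div_eq_one_iff_eq h0).mp (hrat w hw w₀ hw₀ _ (div_pos hwp hc) ?_)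
      refine ((hlim w).div (hlim w₀) h0).congr' ?_
      filter_upwards [he] with n hn
      exact div_div_div_cancel_right₀ hn.ne' _ _
    · push Not at h
      exact ⟨1, one_pos, fun w hw hne => (hne (h w hw)).elim⟩
  obtain ⟨c, hc, hcR⟩ := hcommon
  obtain ⟨a, ha, haa₀, haδ⟩ : ∃ a > 0, a ≤ a₀ ∧ a ≤ δ * c / 4 :=
    ⟨min a₀ (δ * c / 4), by positivity, min_le_left _ _, min_le_right _ _⟩
  obtain ⟨d, hd0, hdδ, hda, hdP⟩ : ∃ d > 0, d < δ / 2 ∧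
      (∀ w ∈ R, d * ∑ i, |w i| < a) ∧
      ∀ w ∈ P, w ⬝ᵥ g ≠ 0 → d * ∑ i, |w i| < a / c * (w ⬝ᵥ g) := by
    have h1 : ∀ᶠ d in 𝓝[>] (0 : ℝ), d < δ / 2 := by
      simpa using eventually_mul_lt_nhdsGT_zero 1 (half_pos hδ)
    have h2 : ∀ᶠ d in 𝓝[>] (0 : ℝ), ∀ w ∈ R, d * ∑ i, |w i| < a :=
      (Finset.eventually_all R).mpr fun w _ => eventually_mul_lt_nhdsGT_zero _ ha
    have h3 : ∀ᶠ d in 𝓝[>] (0 : ℝ), ∀ w ∈ P, w ⬝ᵥ g ≠ 0 →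
        d * ∑ i, |w i| < a / c * (w ⬝ᵥ g) := by
      refine (Finset.eventually_all P).mpr fun w hw => ?_
      by_cases hne : w ⬝ᵥ g = 0
      · simp [hne]
      · have := (hgnn w (Finset.mem_union_left _ hw)).lt_of_ne' hne
        filter_upwards [eventually_mul_lt_nhdsGT_zero (∑ i, |w i|)
          (show 0 < a / c * (w ⬝ᵥ g) by positivity)] with d hd _ using hd
    obtain ⟨d, hd1, hd2, hd3, hd4⟩ :=
      (h1.and (h2.and (h3.and self_mem_nhdsWithin))).exists
    exact ⟨d, hd4, hd1, hd2, hd3⟩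
  have hres : ∀ w : Fin v → ℝ, w ⬝ᵥ g = 0 → ∀ n, w ⬝ᵥ (x n - e n • g) = w ⬝ᵥ x n := by
    intro w hw n
    rw [dotProduct_sub, dotProduct_smul, hw, smul_zero, sub_zero]
  obtain ⟨Y, hYd, hYP, hYR⟩ := ih (S.erase m) (Finset.erase_ssubset hmS)
    (fun n => x n - e n • g) (P.filter fun w => w ⬝ᵥ g = 0) (R.filter fun w => w ⬝ᵥ g = 0)
    (by
      intro i hi
      by_cases him : i = m
      · subst him
        simpa using hgm
      · have hi0 := hS i fun h => hi (Finset.mem_erase.mpr ⟨him, h⟩)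
        filter_upwards [hi0] with n hn
        simp [hn, hg0 i hi0])
    (by
      intro w hw
      rw [← Finset.filter_union, Finset.mem_filter] at hw
      simpa only [hres w hw.2] using hpos w hw.1)
    (by
      intro w hw w' hw' ρ hρ
      rw [Finset.mem_filter] at hw hw'
      simpa only [hres w hw.2, hres w' hw'.2] using hrat w hw.1 w' hw'.1 ρ hρ)
    d hd0
  obtain ⟨z, haz, hza, hz⟩ := hT a ha haa₀ (R.image fun w => w ⬝ᵥ Y) (by
    intro f hf
    obtain ⟨w, hw, rfl⟩ := Finset.mem_image.mp hf
    exact (abs_dotProduct_le_mul_sum w Y hYd).trans_lt (hda w hw))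
  have hzc : a / c < z / c := by gcongr
  have hzc0 : 0 < z / c := (div_pos ha hc).trans hzc
  have hzδ : z / c < δ / 2 := by
    rw [div_lt_iff₀ hc]
    linarith
  have hdot : ∀ w : Fin v → ℝ, w ⬝ᵥ (Y + (z / c) • g) = w ⬝ᵥ Y + z / c * (w ⬝ᵥ g) := by
    intro w
    rw [dotProduct_add, dotProduct_smul, smul_eq_mul]
  refine ⟨Y + (z / c) • g, fun i => ?_, fun w hw => ?_, fun w hw => ?_⟩
  · have h1 : |z / c * g i| ≤ z / c := by
      rw [abs_mul, abs_of_pos hzc0]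
      exact mul_le_of_le_one_right hzc0.le (hg1 i)
    have h2 := abs_add_le (Y i) (z / c * g i)
    have h3 := hYd i
    simp only [Pi.add_apply, Pi.smul_apply, smul_eq_mul]
    linarith
  · rw [hdot]
    by_cases hne : w ⬝ᵥ g = 0
    · simpa [hne] using hYP w (Finset.mem_filter.mpr ⟨hw, hne⟩)
    · have hwp := (hgnn w (Finset.mem_union_left _ hw)).lt_of_ne' hne
      have h1 := abs_dotProduct_le_mul_sum w Y hYd
      have h2 := hdP w hw hne
      have h3 : a / c * (w ⬝ᵥ g) < z / c * (w ⬝ᵥ g) := by gcongr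
      have h4 := neg_abs_le (w ⬝ᵥ Y)
      linarith
  · rw [hdot]
    by_cases hne : w ⬝ᵥ g = 0
    · simpa [hne] using hYR w (Finset.mem_filter.mpr ⟨hw, hne⟩)
    · rw [hcR w hw hne, div_mul_cancel₀ _ hc.ne', add_comm]
      exact hz _ (Finset.mem_image_of_mem _ hw)

/-- Two reals within distance `n` of each other whose `n`-fold multiples have integer parts
congruent modulo `n ^ 2 + 2` are at distance at most `1 / n`. -/
lemma abs_sub_le_of_floor_modEq {n : ℕ} (hn : 0 < n) {s t : ℝ} (hst : |s - t| ≤ n)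
    (h : ((⌊n * s⌋ : ℤ) : ZMod (n ^ 2 + 1 + 1)) = ((⌊n * t⌋ : ℤ) : ZMod (n ^ 2 + 1 + 1))) :
    |s - t| ≤ 1 / n := by
  have hn' : (0 : ℝ) < n := by exact_mod_cast hn
  rw [ZMod.intCast_eq_intCast_iff_dvd_sub] at h
  have hmul : |(n : ℝ) * s - n * t| ≤ (n : ℝ) ^ 2 := by
    rw [← mul_sub, abs_mul, abs_of_pos hn', sq]
    gcongr
  have hfl : |(⌊(n : ℝ) * t⌋ - ⌊(n : ℝ) * s⌋ : ℤ)| < ((n ^ 2 + 1 + 1 : ℕ) : ℤ) := by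
    have h1 := Int.floor_le ((n : ℝ) * s)
    have h2 := Int.lt_floor_add_one ((n : ℝ) * s)
    have h3 := Int.floor_le ((n : ℝ) * t)
    have h4 := Int.lt_floor_add_one ((n : ℝ) * t)
    obtain ⟨h5, h6⟩ := abs_le.mp hmul
    have : |((⌊(n : ℝ) * t⌋ - ⌊(n : ℝ) * s⌋ : ℤ) : ℝ)| < (n : ℝ) ^ 2 + 1 + 1 := by
      push_cast
      rw [abs_lt]
      constructor <;> linarith
    exact_mod_cast this
  have heq := sub_eq_zero.mp (Int.eq_zero_of_abs_lt_dvd h hfl)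
  have hlt := Int.abs_sub_lt_one_of_floor_eq_floor heq.symm
  rw [← mul_sub, abs_mul, abs_of_pos hn'] at hlt
  rw [le_div_iff₀ hn', mul_comm]
  exact hlt.le

open Topology in
/-- For an image partition regular matrix there is a sequence of positive vectors for which any
two comparable entries of the image are asymptotically equal. -/
lemma IPR.exists_seq {u v : ℕ} {M : Fin u → Fin v → ℝ} (hM : IPR M) (U : Ultrafilter ℕ)
    (hU : (U : Filter ℕ) ≤ atTop) :
    ∃ x : ℕ → Fin v → ℝ, (∀ n j, 0 < x n j) ∧ (∀ n i, 0 < M i ⬝ᵥ x n) ∧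
      ∀ i k, ∀ ρ : ℝ, 0 < ρ →
        Tendsto (fun n => (M i ⬝ᵥ x n) / (M k ⬝ᵥ x n)) U (𝓝 ρ) → ρ = 1 := by
  have hcol : ∀ n : ℕ, ∃ x : Fin v → ℝ, (∀ j, 0 < x j) ∧ (∀ i, 0 < M i ⬝ᵥ x) ∧
      ∃ t : ZMod (n ^ 2 + 1 + 1), ∀ i,
        ((⌊n * Real.log (M i ⬝ᵥ x)⌋ : ℤ) : ZMod (n ^ 2 + 1 + 1)) = t := by
    intro n
    obtain ⟨t, x, hx⟩ := hM (n ^ 2 + 1 + 1)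
      fun a => ((⌊n * Real.log (a : ℝ)⌋ : ℤ) : ZMod (n ^ 2 + 1 + 1))
    exact ⟨fun j => x j, fun j => (x j).2, fun i => (hx i).1, t, fun i => (hx i).2⟩
  choose x hx0 hMx t ht using hcol
  refine ⟨x, hx0, hMx, fun i k ρ hρ hlim => ?_⟩
  have hlog : Tendsto (fun n => Real.log (M i ⬝ᵥ x n) - Real.log (M k ⬝ᵥ x n)) U
      (𝓝 (Real.log ρ)) :=
    (hlim.log hρ.ne').congr fun n => Real.log_div (hMx n i).ne' (hMx n k).ne'
  have hzero : Tendsto (fun n => Real.log (M i ⬝ᵥ x n) - Real.log (M k ⬝ᵥ x n)) U (𝓝 0) := by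
    refine squeeze_zero_norm' ?_ ((tendsto_one_div_atTop_nhds_zero_nat (𝕜 := ℝ)).mono_left hU)
    have hK : ∀ᶠ n : ℕ in U, |Real.log ρ| + 1 ≤ (n : ℝ) :=
      hU (tendsto_natCast_atTop_atTop.eventually (eventually_ge_atTop _))
    filter_upwards [hlog.abs.eventually (gt_mem_nhds (lt_add_one _)), hK,
      hU (eventually_gt_atTop 0)] with n h1 h2 h3
    exact abs_sub_le_of_floor_modEq h3 (h1.le.trans h2) ((ht n i).trans (ht n k).symm)
  have := tendsto_nhds_unique hlog hzero
  rw [← Real.exp_log hρ, this, Real.exp_zero]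

/-- A thick set near zero has a witnessing ultrafilter at zero containing all its small
translates. -/
lemma Thick1.exists_ultrafilter {A : Set Rpos} (hA : Thick1 A) :
    ∃ q ∈ zeroPlus1, ∃ ε > 0, ∀ a : Rpos, (a : ℝ) < ε → ∀ᶠ y in (q : Filter Rpos), a + y ∈ A := by
  obtain ⟨L, ⟨⟨q, hq⟩, hLT, hL⟩, hAL⟩ := hA
  refine ⟨q, hLT hq, ?_⟩
  by_contra! hcon
  let Z : Filter Rpos := comap Subtype.val (nhds 0)
  have hfreq : ∃ᶠ a in Z, ¬ ∀ᶠ y in (q : Filter Rpos), a + y ∈ A := by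
    intro hev
    simp only [not_not] at hev
    obtain ⟨t, ht, htA⟩ := mem_comap.mp hev
    obtain ⟨ε, hε, hball⟩ := Metric.mem_nhds_iff.mp ht
    obtain ⟨a, ha, hna⟩ := hcon ε hε
    refine Ultrafilter.eventually_not.mp hna (htA (hball ?_))
    rwa [Metric.mem_ball, Real.dist_eq, sub_zero, abs_of_pos a.2]
  have : NeBot (Z ⊓ 𝓟 {a | ¬ ∀ᶠ y in (q : Filter Rpos), a + y ∈ A}) :=
    frequently_mem_iff_neBot.mp hfreq
  let p := Ultrafilter.of (Z ⊓ 𝓟 {a | ¬ ∀ᶠ y in (q : Filter Rpos), a + y ∈ A})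
  have hp := Ultrafilter.of_le (Z ⊓ 𝓟 {a | ¬ ∀ᶠ y in (q : Filter Rpos), a + y ∈ A})
  have hp0 : p ∈ zeroPlus1 := fun ε hε =>
    hp (mem_inf_of_left (preimage_mem_comap (gt_mem_nhds hε)))
  have h1 : ∀ᶠ a in (p : Filter Rpos), ∀ᶠ y in (q : Filter Rpos), a + y ∈ A :=
    (Ultrafilter.eventually_add p q (· ∈ A)).mp (hAL _ (hL p hp0 q hq))
  have h2 : ∀ᶠ a in (p : Filter Rpos), ¬ ∀ᶠ y in (q : Filter Rpos), a + y ∈ A :=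
    hp (mem_inf_of_right (mem_principal_self _))
  obtain ⟨a, ha, hna⟩ := (h1.and h2).exists
  exact hna ha

lemma add_mem_zeroPlusV {v : ℕ} {p q : Ultrafilter (Fin v → Rpos)} (hp : p ∈ zeroPlusV v)
    (hq : q ∈ zeroPlusV v) : p + q ∈ zeroPlusV v := by
  intro ε hε
  refine (Ultrafilter.eventually_add p q fun x => ∀ j, (x j : ℝ) < ε).mpr ?_
  filter_upwards [hp _ (half_pos hε)] with x hx
  filter_upwards [hq _ (half_pos hε)] with y hy j
  have h1 := hx j
  have h2 := hy j
  change (x j : ℝ) + (y j : ℝ) < ε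
  linarith

/-- A set is thick near zero if finite sets of small vectors have arbitrarily small translates
inside it. -/
lemma ThickV.of_finset {v : ℕ} {A : Set (Fin v → Rpos)} {ε : ℝ} (hε : 0 < ε)
    (hA : ∀ F : Finset (Fin v → Rpos), (∀ x ∈ F, ∀ j, (x j : ℝ) < ε) → ∀ δ > 0,
      ∃ y : Fin v → Rpos, (∀ j, (y j : ℝ) < δ) ∧ ∀ x ∈ F, x + y ∈ A) : ThickV v A := by
  classical
  have hsel : ∀ s : Finset (Fin v → Rpos) × ℕ, ∃ y : Fin v → Rpos,
      (∀ j, (y j : ℝ) < 1 / ((s.2 : ℝ) + 1)) ∧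
      ∀ x ∈ s.1, (∀ j, (x j : ℝ) < ε) → x + y ∈ A := by
    intro s
    obtain ⟨y, hy, hyA⟩ := hA (s.1.filter fun x => ∀ j, (x j : ℝ) < ε)
      (fun x hx => (Finset.mem_filter.mp hx).2) (1 / ((s.2 : ℝ) + 1)) (by positivity)
    exact ⟨y, hy, fun x hx hxε => hyA x (Finset.mem_filter.mpr ⟨hx, hxε⟩)⟩
  choose y hy hyA using hsel
  let q := Ultrafilter.of (map y atTop)
  have hq : (q : Filter _) ≤ map y atTop := Ultrafilter.of_le _
  have hq0 : q ∈ zeroPlusV v := by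
    intro δ hδ
    obtain ⟨n, hn⟩ := exists_nat_one_div_lt hδ
    refine hq (mem_map.mpr ?_)
    filter_upwards [eventually_ge_atTop ((∅ : Finset (Fin v → Rpos)), n)] with s hs j
    have hns : (n : ℝ) ≤ s.2 := by exact_mod_cast hs.2
    refine (hy s j).trans_le (le_trans ?_ hn.le)
    gcongr
  have hqA : ∀ x : Fin v → Rpos, (∀ j, (x j : ℝ) < ε) →
      ∀ᶠ z in (q : Filter (Fin v → Rpos)), x + z ∈ A := by
    intro x hx
    refine hq (mem_map.mpr ?_)
    filter_upwards [eventually_ge_atTop (({x} : Finset (Fin v → Rpos)), 0)] with s hs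
    exact hyA s x (hs.1 (Finset.mem_singleton_self x)) hx
  refine ⟨{r | ∃ p ∈ zeroPlusV v, r = p + q}, ⟨⟨q + q, q, hq0, rfl⟩, ?_, ?_⟩, ?_⟩
  · rintro _ ⟨p, hp, rfl⟩
    exact add_mem_zeroPlusV hp hq0
  · rintro p' hp' _ ⟨p, hp, rfl⟩
    exact ⟨p' + p, add_mem_zeroPlusV hp' hp, (add_assoc p' p q).symm⟩
  · rintro _ ⟨p, hp, rfl⟩
    refine (Ultrafilter.eventually_add p q (· ∈ A)).mpr ?_
    filter_upwards [hp ε hε] with x hx using hqA x hx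

/-- If `M` is a `u × v` matrix with entries from `ℝ⁺ ∪ {0}` which is IPR/ℝ⁺ and `C ⊆ ℝ⁺`
is thick near zero in `ℝ⁺`, then `{x ∈ (ℝ⁺)^v : M·x ∈ C^u}` is thick near zero in
`(ℝ⁺)^v`. -/
theorem thick_preserved {u v : ℕ} (hu : 1 ≤ u) (hv : 1 ≤ v)
    (M : Fin u → Fin v → ℝ) (hMnn : ∀ i j, 0 ≤ M i j) (hIPR : IPR M)
    (C : Set ℝ) (hC : C ⊆ Set.Ioi 0) (hT : Thick1 {a : Rpos | (a : ℝ) ∈ C}) :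
    ThickV v {x : Fin v → Rpos | ∀ i : Fin u, (∑ j, M i j * (x j : ℝ)) ∈ C} := by
  classical
  obtain ⟨q, hq0, ε, hε, hq⟩ := hT.exists_ultrafilter
  have hqC : ∀ t : ℝ, 0 < t → t < ε → ∀ᶠ y : Rpos in q, t + (y : ℝ) ∈ C :=
    fun t ht htε => hq ⟨t, ht⟩ htε
  obtain ⟨x, hx0, hMx, hrat⟩ :=
    hIPR.exists_seq (Ultrafilter.of atTop) (Ultrafilter.of_le atTop)
  set K : ℝ := ∑ i, ∑ j, M i j with hK
  have hrow : ∀ i, ∑ j, M i j ≤ K := fun i =>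
    Finset.single_le_sum (f := fun i => ∑ j, M i j)
      (fun i _ => Finset.sum_nonneg fun j _ => hMnn i j) (Finset.mem_univ i)
  have hK0 : 0 ≤ K := Finset.sum_nonneg fun i _ => Finset.sum_nonneg fun j _ => hMnn i j
  refine ThickV.of_finset (ε := ε / 2 / (K + 1)) (by positivity) fun F hF δ hδ => ?_
  have hsmall : ∀ f ∈ F, ∀ i, 0 ≤ ∑ j, M i j * (f j : ℝ) ∧ ∑ j, M i j * (f j : ℝ) < ε / 2 := by
    intro f hf i
    refine ⟨Finset.sum_nonneg fun j _ => mul_nonneg (hMnn i j) (f j).2.le, ?_⟩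
    calc ∑ j, M i j * (f j : ℝ) ≤ ∑ j, M i j * (ε / 2 / (K + 1)) :=
          Finset.sum_le_sum fun j _ => mul_le_mul_of_nonneg_left (hF f hf j).le (hMnn i j)
      _ = (∑ j, M i j) * (ε / 2 / (K + 1)) := (Finset.sum_mul ..).symm
      _ ≤ K * (ε / 2 / (K + 1)) := by
          gcongr
          exact hrow i
      _ < (K + 1) * (ε / 2 / (K + 1)) := by
          gcongr
          exact lt_add_one K
      _ = ε / 2 := mul_div_cancel₀ _ (by positivity)
  obtain ⟨Y, hYδ, hYpos, hYC⟩ := exists_small_vector_dotProduct_mem (Ultrafilter.of atTop)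
    {z | ∀ f ∈ F, ∀ i, z + ∑ j, M i j * (f j : ℝ) ∈ C} (a₀ := ε / 4) (by positivity)
    (by
      intro a ha haε G hG
      have hGC : ∀ᶠ y : Rpos in q, ∀ b ∈ G, ∀ f ∈ F, ∀ i,
          (a + b + ∑ j, M i j * (f j : ℝ)) + (y : ℝ) ∈ C := by
        refine (Finset.eventually_all G).mpr fun b hb => (Finset.eventually_all F).mpr
          fun f hf => eventually_all.mpr fun i => hqC _ ?_ ?_
        all_goals
          have h1 := abs_lt.mp (hG b hb)
          have h2 := hsmall f hf i
          linarith
      obtain ⟨y, hya, hyC⟩ := ((show ∀ᶠ y : Rpos in q, (y : ℝ) < a from hq0 a ha).and hGC).exists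
      have hy0 := y.2
      refine ⟨a + y, by linarith, by linarith, fun b hb f hf i => ?_⟩
      convert hyC b hb f hf i using 1
      ring)
    Finset.univ x (Finset.univ.image fun j => Pi.single j 1) (Finset.univ.image M)
    (fun i hi => (hi (Finset.mem_univ i)).elim)
    (by
      intro w hw
      refine Eventually.of_forall fun n => ?_
      rcases Finset.mem_union.mp hw with hw | hw
      · obtain ⟨j, -, rfl⟩ := Finset.mem_image.mp hw
        simpa using hx0 n j
      · obtain ⟨i, -, rfl⟩ := Finset.mem_image.mp hw
        exact hMx n i)
    (by
      intro w hw w' hw'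
      obtain ⟨i, -, rfl⟩ := Finset.mem_image.mp hw
      obtain ⟨k, -, rfl⟩ := Finset.mem_image.mp hw'
      exact hrat i k)
    δ hδ
  have hY0 : ∀ j, 0 < Y j := fun j => by
    simpa using hYpos (Pi.single j 1) (Finset.mem_image_of_mem _ (Finset.mem_univ j))
  refine ⟨fun j => ⟨Y j, hY0 j⟩, fun j => (le_abs_self _).trans_lt (hYδ j), fun f hf i => ?_⟩
  have hmem := hYC (M i) (Finset.mem_image_of_mem _ (Finset.mem_univ i)) f hf i
  convert hmem using 1
  rw [dotProduct, ← Finset.sum_add_distrib]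
  refine Finset.sum_congr rfl fun j _ => ?_
  change M i j * ((f j : ℝ) + Y j) = _
  ring
end
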